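/- arXiv:1309.3344 — 4 statements merged into one kernel-verified Lean document; each statement's English description precedes it below -/
import Mathlib

section
/- Let u = (u¹,u²,u³) ∈ ℝ³ and n = (n¹,n²,n³) ∈ ℝ³, and let N(n,u) = n¹N₁ + n²N₂ + n³N₃ be the flux Jacobian of the magnetic vector potential system. Then the characteristic polynomial of N(n,u) is X·(X − (n·u))²; in particular the eigenvalues of N(n,u) are λ¹ = 0 and the double eigenvalue λ² = λ³ = n·u. -/
/-- Coefficient matrix `N₁` of the magnetic vector potential system. -/
def N1 (u : Fin 3 → ℝ) : Matrix (Fin 3) (Fin 3) ℝ :=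
  !![0, -u 1, -u 2; 0, u 0, 0; 0, 0, u 0]

/-- Coefficient matrix `N₂` of the magnetic vector potential system. -/
def N2 (u : Fin 3 → ℝ) : Matrix (Fin 3) (Fin 3) ℝ :=
  !![u 1, 0, 0; -u 0, 0, -u 2; 0, 0, u 1]

/-- Coefficient matrix `N₃` of the magnetic vector potential system. -/
def N3 (u : Fin 3 → ℝ) : Matrix (Fin 3) (Fin 3) ℝ :=
  !![u 2, 0, 0; 0, u 2, 0; -u 0, -u 1, 0]

/-- The flux Jacobian `N(n,u) = n¹N₁ + n²N₂ + n³N₃` in direction `n`. -/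
def Nmat (n u : Fin 3 → ℝ) : Matrix (Fin 3) (Fin 3) ℝ :=
  n 0 • N1 u + n 1 • N2 u + n 2 • N3 u

/-- The characteristic polynomial of the flux Jacobian `N(n,u)` of the
magnetic vector potential system is `X (X - n·u)²`; in particular its
eigenvalues are `0` and the double eigenvalue `n·u`. -/
theorem charpoly_potential_flux_jacobian (u n : Fin 3 → ℝ) :
    (Nmat n u).charpoly =
      Polynomial.X *
        (Polynomial.X - Polynomial.C (n 0 * u 0 + n 1 * u 1 + n 2 * u 2)) ^ 2 := by
  rw [Matrix.charpoly, Matrix.det_fin_three]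
  simp [Matrix.charmatrix_apply, Nmat, N1, N2, N3]
  ring
end

section
/- Let u, n ∈ ℝ³ and let R be the 3×3 matrix whose columns are n, n × u, and (u·n)u − ‖u‖²n (the right eigenvectors of the potential-system flux Jacobian N(n,u)). Then det(R) = −(u·n)·(‖n‖²‖u‖² − (u·n)²). In particular, if ‖n‖ = 1 and ‖u‖ ≠ 0, then det(R) = −‖u‖³ cos(α) sin²(α), where α is the angle between n and u. -/
open Real Matrix

/-- The cross product `n × u` in ℝ³. -/
def cross (n u : Fin 3 → ℝ) : Fin 3 → ℝ :=
  ![n 1 * u 2 - n 2 * u 1, n 2 * u 0 - n 0 * u 2, n 0 * u 1 - n 1 * u 0]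

/-- The Euclidean dot product on ℝ³. -/
def dot3 (a b : Fin 3 → ℝ) : ℝ := a 0 * b 0 + a 1 * b 1 + a 2 * b 2

/-- The matrix `R = [n | n×u | (u·n)u − ‖u‖²n]` of right eigenvectors of the
flux Jacobian `N(n,u)` of the magnetic vector potential system: its columns
are `n`, `n × u`, and `(u·n)u − ‖u‖²n`. -/
def Rmat (n u : Fin 3 → ℝ) : Matrix (Fin 3) (Fin 3) ℝ :=
  (Matrix.of ![n, cross n u, dot3 u n • u - dot3 u u • n])ᵀ

/-- The determinant of the eigenvector matrix `R = [n | n×u | (u·n)u − ‖u‖²n]`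
satisfies `det R = −(u·n)(‖n‖²‖u‖² − (u·n)²)`.  In particular, if `‖n‖ = 1`
and `‖u‖ ≠ 0`, then `det R = −‖u‖³ cos α sin² α`, where `α` is the angle
between `n` and `u`. -/
theorem det_potential_eigenvector_matrix (u n : Fin 3 → ℝ) :
    (Rmat n u).det = -(dot3 u n) * (dot3 n n * dot3 u u - dot3 u n ^ 2) ∧
    ((dot3 n n = 1) → u ≠ 0 →
      (Rmat n u).det =
        -(Real.sqrt (dot3 u u)) ^ 3 *
            Real.cos (Real.arccos (dot3 n u /
              (Real.sqrt (dot3 n n) * Real.sqrt (dot3 u u)))) *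
            Real.sin (Real.arccos (dot3 n u /
              (Real.sqrt (dot3 n n) * Real.sqrt (dot3 u u)))) ^ 2) := by
  have hdet : (Rmat n u).det = -(dot3 u n) * (dot3 n n * dot3 u u - dot3 u n ^ 2) := by
    rw [Rmat, Matrix.det_transpose, Matrix.det_fin_three]
    simp [cross, dot3]
    ring
  refine ⟨hdet, fun hn hu => ?_⟩
  have hcomm : dot3 u n = dot3 n u := by simp only [dot3]; ring
  have hpos : 0 < dot3 u u := by
    by_contra h
    apply hu
    simp only [dot3] at h
    have h0 : u 0 = 0 := by nlinarith [sq_nonneg (u 0), sq_nonneg (u 1), sq_nonneg (u 2)]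
    have h1 : u 1 = 0 := by nlinarith [sq_nonneg (u 0), sq_nonneg (u 1), sq_nonneg (u 2)]
    have h2 : u 2 = 0 := by nlinarith [sq_nonneg (u 0), sq_nonneg (u 1), sq_nonneg (u 2)]
    funext i
    fin_cases i <;> simp [h0, h1, h2]
  have hcs : dot3 n u ^ 2 ≤ dot3 n n * dot3 u u := by
    simp only [dot3]
    nlinarith [sq_nonneg (n 0 * u 1 - n 1 * u 0), sq_nonneg (n 1 * u 2 - n 2 * u 1),
      sq_nonneg (n 2 * u 0 - n 0 * u 2)]
  rw [hdet, hcomm, hn, Real.sqrt_one, one_mul, one_mul]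
  rw [hn, one_mul] at hcs
  have hs : 0 < Real.sqrt (dot3 u u) := Real.sqrt_pos.mpr hpos
  have hsq : Real.sqrt (dot3 u u) ^ 2 = dot3 u u := Real.sq_sqrt hpos.le
  generalize Real.sqrt (dot3 u u) = s at *
  have habs : |dot3 n u / s| ≤ 1 := by
    rw [← sq_le_one_iff_abs_le_one, div_pow, div_le_one (by positivity), hsq]
    exact hcs
  rw [Real.sin_sq, Real.cos_arccos (abs_le.mp habs).1 (abs_le.mp habs).2, ← hsq]
  field_simp
end

section
/- Let u, n ∈ ℝ³ with ‖n‖ = 1 and u ≠ 0, and let R = [n | n×u | (u·n)u − ‖u‖²n] be the matrix of right eigenvectors of the potential-system flux Jacobian N(n,u). Then det(R) = 0 if and only if n·u = 0 or (n·u)² = ‖u‖² (i.e., if and only if n is orthogonal to u or parallel to u). Consequently, in these degenerate directions the eigenvectors of N(n,u) do not span ℝ³, so the magnetic vector potential system is only weakly hyperbolic. -/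
open Real Matrix

/-- For a unit direction `n` and nonzero velocity `u`, the determinant of the
eigenvector matrix `R = [n | n×u | (u·n)u − ‖u‖²n]` vanishes precisely when
`n·u = 0` or `(n·u)² = ‖u‖²` (i.e. `n` orthogonal or parallel to `u`), and in
these degenerate directions the eigenvectors do not span ℝ³: the magnetic
vector potential system is only weakly hyperbolic. -/
theorem potential_system_weakly_hyperbolic (u n : Fin 3 → ℝ)
    (hn : dot3 n n = 1) (hu : u ≠ 0) :
    ((Rmat n u).det = 0 ↔ dot3 n u = 0 ∨ dot3 n u ^ 2 = dot3 u u) ∧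
    ((Rmat n u).det = 0 →
      Submodule.span ℝ ({n, cross n u, dot3 u n • u - dot3 u u • n} :
        Set (Fin 3 → ℝ)) ≠ ⊤) := by
  have hdet : (Rmat n u).det = -(dot3 n u * (dot3 n n * dot3 u u - dot3 n u ^ 2)) := by
    rw [Rmat, Matrix.det_transpose, Matrix.det_fin_three]
    simp [cross, dot3]
    ring
  refine ⟨?_, ?_⟩
  · rw [hdet, hn, neg_eq_zero, mul_eq_zero, one_mul, sub_eq_zero]
    exact or_congr Iff.rfl eq_comm
  · intro h0 htop
    obtain ⟨v, hv, hvR⟩ := Matrix.exists_vecMul_eq_zero_iff.mpr h0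
    have hcol : ∀ j, v ⬝ᵥ (fun i => Rmat n u i j) = 0 := fun j => congrFun hvR j
    have key : ∀ x : Fin 3 → ℝ, v ⬝ᵥ x = 0 := by
      intro x
      have hx : x ∈ Submodule.span ℝ ({n, cross n u, dot3 u n • u - dot3 u u • n} :
          Set (Fin 3 → ℝ)) := by rw [htop]; trivial
      induction hx using Submodule.span_induction with
      | mem y hy =>
        rcases hy with rfl | rfl | rfl
        · exact hcol 0
        · exact hcol 1
        · exact hcol 2
      | zero => exact dotProduct_zero v
      | add a b _ _ ha hb => rw [dotProduct_add, ha, hb, add_zero]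
      | smul c a _ ha => rw [dotProduct_smul, ha, smul_zero]
    exact hv (dotProduct_self_eq_zero.mp (key v))
end

section
/- Let A¹, A², A³ : ℤ³ → ℝ, and let Δx, Δy, Δz > 0. Define the fourth-order central difference operators Dˣ, Dʸ, Dᶻ by (Dˣ A)(i,j,k) = (A(i−2,j,k) − 8A(i−1,j,k) + 8A(i+1,j,k) − A(i+2,j,k))/(12Δx), and analogously for Dʸ (in j) and Dᶻ (in k). Define the discrete curl B¹ = Dʸ A³ − Dᶻ A², B² = Dᶻ A¹ − Dˣ A³, B³ = Dˣ A² − Dʸ A¹. Then the discrete divergence vanishes identically: (Dˣ B¹)(i,j,k) + (Dʸ B²)(i,j,k) + (Dᶻ B³)(i,j,k) = 0 for all (i,j,k) ∈ ℤ³. -/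
/-- Fourth-order central difference in the `x`-direction on a 3D grid. -/
noncomputable def Dx (Δx : ℝ) (A : ℤ × ℤ × ℤ → ℝ) : ℤ × ℤ × ℤ → ℝ := fun p =>
  (A (p.1 - 2, p.2.1, p.2.2) - 8 * A (p.1 - 1, p.2.1, p.2.2)
      + 8 * A (p.1 + 1, p.2.1, p.2.2) - A (p.1 + 2, p.2.1, p.2.2)) / (12 * Δx)

/-- Fourth-order central difference in the `y`-direction on a 3D grid. -/
noncomputable def Dy (Δy : ℝ) (A : ℤ × ℤ × ℤ → ℝ) : ℤ × ℤ × ℤ → ℝ := fun p =>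
  (A (p.1, p.2.1 - 2, p.2.2) - 8 * A (p.1, p.2.1 - 1, p.2.2)
      + 8 * A (p.1, p.2.1 + 1, p.2.2) - A (p.1, p.2.1 + 2, p.2.2)) / (12 * Δy)

/-- Fourth-order central difference in the `z`-direction on a 3D grid. -/
noncomputable def Dz (Δz : ℝ) (A : ℤ × ℤ × ℤ → ℝ) : ℤ × ℤ × ℤ → ℝ := fun p =>
  (A (p.1, p.2.1, p.2.2 - 2) - 8 * A (p.1, p.2.1, p.2.2 - 1)
      + 8 * A (p.1, p.2.1, p.2.2 + 1) - A (p.1, p.2.1, p.2.2 + 2)) / (12 * Δz)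

/-- For the discrete 3D curl `B¹ = Dʸ A³ − Dᶻ A²`, `B² = Dᶻ A¹ − Dˣ A³`,
`B³ = Dˣ A² − Dʸ A¹` built from fourth-order central differences, the discrete
divergence `Dˣ B¹ + Dʸ B² + Dᶻ B³` vanishes identically. -/
theorem discrete_curl_is_divergence_free_3d (A1 A2 A3 : ℤ × ℤ × ℤ → ℝ)
    (Δx Δy Δz : ℝ) (hx : 0 < Δx) (hy : 0 < Δy) (hz : 0 < Δz) :
    ∀ p : ℤ × ℤ × ℤ,
      Dx Δx (Dy Δy A3 - Dz Δz A2) p + Dy Δy (Dz Δz A1 - Dx Δx A3) p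
        + Dz Δz (Dx Δx A2 - Dy Δy A1) p = 0 := by
  intro p
  simp only [Dx, Dy, Dz, Pi.sub_apply]
  ring
end
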